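/- Let p be a prime number and K a field with char K = p. For every positive integer r, ed_K((Z/pZ)^r) = 1 if and only if the dimension of K as a vector space over its prime subfield F_p is at least r. -/

import Mathlib

noncomputable section

/-- The transcendence degree of `L` over `K`: the supremum of the cardinalities of
algebraically independent subsets of `L`. -/
noncomputable def trdeg (K L : Type*) [CommRing K] [CommRing L] [Algebra K L] : Cardinal :=
  ⨆ s : {s : Set L // AlgebraicIndependent K ((↑) : s → L)}, Cardinal.mk s.1

/-- The rational function field over `K` on variables indexed by `σ` :
the fraction field of the polynomial ring `K[x_i : i ∈ σ]`. -/
abbrev FnField (K : Type*) [Field K] (σ : Type*) : Type _ :=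
  FractionRing (MvPolynomial σ K)

/-- Permutations of the variables acting on the polynomial ring by `K`-algebra
automorphisms. -/
noncomputable def permHom (K : Type*) [Field K] (σ : Type*) :
    Equiv.Perm σ →* (MvPolynomial σ K ≃ₐ[K] MvPolynomial σ K) where
  toFun e := MvPolynomial.renameEquiv K e
  map_one' := MvPolynomial.renameEquiv_refl K
  map_mul' e f := by
    ext x
    simp [MvPolynomial.renameEquiv, Equiv.Perm.mul_apply]

/-- Permutations of the variables acting on the rational function field by
`K`-algebra automorphisms. -/
noncomputable def permGalAction (K : Type*) [Field K] (σ : Type*) :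
    Equiv.Perm σ →* (FnField K σ ≃ₐ[K] FnField K σ) :=
  (IsFractionRing.fieldEquivOfAlgEquivHom K (FnField K σ)).comp (permHom K σ)

/-- The action of a group `G` on its rational function field `K(x_g : g ∈ G)` by
`K`-algebra automorphisms, permuting the variables by left translation:
`σ • x_g = x_{σg}`. -/
noncomputable def galAction (K : Type*) [Field K] (G : Type*) [Group G] :
    G →* (FnField K G ≃ₐ[K] FnField K G) :=
  (permGalAction K G).comp (MulAction.toPermHom G G)

/-- The essential dimension of a group `G` over the field `K`:
the minimum of the transcendence degrees over `K` of the `G`-stable intermediate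
subfields of the rational function field `K(x_g : g ∈ G)` on which `G` acts
faithfully. -/
noncomputable def edK (K : Type*) [Field K] (G : Type*) [Group G] : ℕ :=
  sInf { d : ℕ | ∃ E : IntermediateField K (FnField K G),
    (∀ g : G, ∀ x ∈ E, galAction K G g x ∈ E) ∧
    (∀ g : G, g ≠ 1 → ∃ x ∈ E, galAction K G g x ≠ x) ∧
    trdeg K E = d }

theorem exists_algHom_polynomial_ne_zero {K σ : Type*} [Field K] {f : MvPolynomial σ K}
    (hf : f ≠ 0) : ∃ ψ : MvPolynomial σ K →ₐ[K] Polynomial K, ψ f ≠ 0 := by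
  by_contra! h
  refine hf (MvPolynomial.map_injective (Polynomial.C : K →+* Polynomial K)
    Polynomial.C_injective ?_)
  refine MvPolynomial.funext fun x => ?_
  simpa [MvPolynomial.eval_map, MvPolynomial.aeval_def] using h (MvPolynomial.aeval x)

/-- Finitely many rational functions in several variables can be specialised simultaneously to
rational functions in one variable, the nonzero ones staying nonzero. -/
theorem exists_algHom_ratFunc_ne_zero {K σ : Type*} [Field K] {S : Set (FnField K σ)}
    (hS : S.Finite) :
    ∃ (A : Subalgebra K (FnField K σ)) (φ : A →ₐ[K] RatFunc K),
      ∀ x ∈ S, ∃ h : x ∈ A, x ≠ 0 → φ ⟨x, h⟩ ≠ 0 := by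
  classical
  choose a b hb hab using fun x : FnField K σ =>
    IsFractionRing.div_surjective (A := MvPolynomial σ K) x
  let F : MvPolynomial σ K := ∏ x ∈ hS.toFinset, b x * (if a x = 0 then 1 else a x)
  have hF : F ≠ 0 := by
    refine Finset.prod_ne_zero_iff.2 fun x _ => mul_ne_zero (nonZeroDivisors.ne_zero (hb x)) ?_
    split_ifs with h
    · exact one_ne_zero
    · exact h
  obtain ⟨ψ₀, hψ₀⟩ := exists_algHom_polynomial_ne_zero hF
  let ψ : MvPolynomial σ K →ₐ[K] RatFunc K :=
    (IsScalarTower.toAlgHom K (Polynomial K) (RatFunc K)).comp ψ₀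
  have hψ : ψ F ≠ 0 := by
    simpa [ψ] using hψ₀
  let M : Submonoid (MvPolynomial σ K) := (nonZeroDivisors (RatFunc K)).comap ψ
  have hM : M ≤ nonZeroDivisors (MvPolynomial σ K) := fun f hf =>
    mem_nonZeroDivisors_of_ne_zero fun h0 => by
      have : ψ f ≠ 0 := nonZeroDivisors.ne_zero hf
      simp [h0] at this
  have hprod : ∀ x ∈ S, ψ (b x) ≠ 0 ∧ (a x ≠ 0 → ψ (a x) ≠ 0) := by
    intro x hx
    rw [map_prod, Finset.prod_ne_zero_iff] at hψ
    have := hψ x (hS.mem_toFinset.2 hx)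
    rw [map_mul] at this
    refine ⟨left_ne_zero_of_mul this, fun h => ?_⟩
    simpa [h] using right_ne_zero_of_mul this
  let B := Localization.subalgebra.ofField (FnField K σ) M hM
  have hunit : ∀ y : M, IsUnit ((ψ : MvPolynomial σ K →+* RatFunc K) y) := fun y =>
    (nonZeroDivisors.ne_zero y.2 : ψ y ≠ 0).isUnit
  let φ₀ : B →+* RatFunc K := IsLocalization.lift hunit
  have hφ₀ : ∀ f, φ₀ (algebraMap (MvPolynomial σ K) B f) = ψ f := fun f =>
    IsLocalization.lift_eq hunit f
  let φ : B.restrictScalars K →ₐ[K] RatFunc K :=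
    { φ₀ with
      commutes' := fun c => by
        have := hφ₀ (MvPolynomial.C c)
        rw [show ψ (MvPolynomial.C c) = algebraMap K (RatFunc K) c from ψ.commutes c] at this
        exact this }
  refine ⟨B.restrictScalars K, φ, fun x hx => ?_⟩
  have hxB : x ∈ B := ⟨a x, b x, mem_nonZeroDivisors_of_ne_zero (hprod x hx).1,
    by rw [← div_eq_mul_inv, hab]⟩
  refine ⟨hxB, fun hx0 => ?_⟩
  have hbx : algebraMap (MvPolynomial σ K) (FnField K σ) (b x) ≠ 0 :=
    IsFractionRing.to_map_ne_zero_of_mem_nonZeroDivisors (hb x)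
  have hmul : (⟨x, hxB⟩ : B) * algebraMap (MvPolynomial σ K) B (b x) =
      algebraMap (MvPolynomial σ K) B (a x) := by
    ext
    change x * algebraMap (MvPolynomial σ K) (FnField K σ) (b x) =
      algebraMap (MvPolynomial σ K) (FnField K σ) (a x)
    rw [← eq_div_iff hbx, hab]
  have hax : a x ≠ 0 := by
    intro h
    apply hx0
    rw [← hab x, h, map_zero, zero_div]
  have h2 : φ₀ ⟨x, hxB⟩ * ψ (b x) = ψ (a x) := by
    rw [← hφ₀, ← hφ₀, ← map_mul, hmul]
  exact left_ne_zero_of_mul (h2 ▸ (hprod x hx).2 hax)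

theorem mem_range_algebraMap_of_isAlgebraic {K σ : Type*} [Field K] {x : FnField K σ}
    (hx : IsAlgebraic K x) : x ∈ (algebraMap K (FnField K σ)).range := by
  by_contra hxK
  obtain ⟨q, hq0, hq⟩ := hx
  have hfin : (insert x ((fun c => x - algebraMap K (FnField K σ) c) '' q.rootSet K)).Finite :=
    ((Polynomial.rootSet_finite q K).image _).insert x
  obtain ⟨A, φ, hφ⟩ := exists_algHom_ratFunc_ne_zero hfin
  obtain ⟨hxA, -⟩ := hφ x (Set.mem_insert _ _)
  have hq' : Polynomial.aeval (φ ⟨x, hxA⟩) q = 0 := by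
    rw [Polynomial.aeval_algHom_apply]
    have : Polynomial.aeval (⟨x, hxA⟩ : A) q = 0 := by
      ext
      exact (Polynomial.aeval_algHom_apply A.val (⟨x, hxA⟩ : A) q).symm.trans hq
    rw [this, map_zero]
  obtain ⟨c, hc⟩ : ∃ c, φ ⟨x, hxA⟩ = RatFunc.C c := by
    by_contra h
    exact RatFunc.transcendental_of_ne_C _ h ⟨q, hq0, hq'⟩
  have hroot : c ∈ q.rootSet K := by
    refine (Polynomial.mem_rootSet_of_ne hq0).2 ?_
    rw [hc, ← RatFunc.algebraMap_eq_C, Polynomial.aeval_algebraMap_apply] at hq'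
    simpa using hq'
  obtain ⟨hA, hne⟩ := hφ _ (Set.mem_insert_of_mem _ ⟨c, hroot, rfl⟩)
  refine hne (fun h => hxK ⟨c, (sub_eq_zero.1 h).symm⟩) ?_
  have : (⟨x - algebraMap K (FnField K σ) c, hA⟩ : A) = ⟨x, hxA⟩ - algebraMap K A c := rfl
  rw [this, map_sub, hc, AlgHom.commutes, RatFunc.algebraMap_eq_C, sub_self]

section Automorphisms

open Polynomial IntermediateField

/-- The generators of the rational function field `K(X)` over `K`. -/
def ratFuncGenerators (K : Type*) [Field K] : Set (RatFunc K) := {f | K⟮f⟯ = ⊤}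

/-- The fractional linear transformations, written as `u X + b` with `u ≠ 0` or as
`a + e / (X + d)` with `e ≠ 0`. -/
def fracLinear (K : Type*) [Field K] : (Kˣ × K) ⊕ (K × K × Kˣ) → RatFunc K
  | .inl (u, b) => algebraMap K[X] (RatFunc K) (C (u : K) * X + C b)
  | .inr (d, a, e) =>
    algebraMap K[X] (RatFunc K) (C a * (X + C d) + C (e : K)) /
      algebraMap K[X] (RatFunc K) (X + C d)

theorem fracLinear_injective (K : Type*) [Field K] : Function.Injective (fracLinear K) := by
  have hne : ∀ d : K, algebraMap K[X] (RatFunc K) (X + C d) ≠ 0 := fun d =>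
    RatFunc.algebraMap_ne_zero (X_add_C_ne_zero d)
  have key : ∀ (u : Kˣ) (b d a : K) (e : Kˣ),
      fracLinear K (.inl (u, b)) ≠ fracLinear K (.inr (d, a, e)) := by
    intro u b d a e h
    simp only [fracLinear] at h
    rw [eq_div_iff (hne d), ← map_mul] at h
    have := congrArg (eval (-d)) (RatFunc.algebraMap_injective K h)
    simp only [eval_mul, eval_add, eval_C, eval_X, neg_add_cancel, mul_zero, zero_add] at this
    exact e.ne_zero this.symm
  rintro (⟨u, b⟩ | ⟨d, a, e⟩) (⟨u', b'⟩ | ⟨d', a', e'⟩) h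
  · simp only [fracLinear] at h
    have h := RatFunc.algebraMap_injective K h
    have h0 := congrArg (eval 0) h
    have h1 := congrArg (eval 1) h
    simp at h0
    simp [h0] at h1
    simp [h0, Units.ext h1]
  · exact (key _ _ _ _ _ h).elim
  · exact (key _ _ _ _ _ h.symm).elim
  · simp only [fracLinear] at h
    rw [div_eq_div_iff (hne d) (hne d'), ← map_mul, ← map_mul] at h
    have h := RatFunc.algebraMap_injective K h
    have hd := congrArg (eval (-d)) h
    simp at hd
    obtain rfl : d' = d := by linear_combination hd
    have h := mul_right_cancel₀ (X_add_C_ne_zero d') h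
    have h0 := congrArg (eval (-d')) h
    have h1 := congrArg (eval (1 - d')) h
    simp at h0
    simp [h0] at h1
    simp [Units.ext h0, h1]

theorem range_fracLinear (K : Type*) [Field K] :
    Set.range (fracLinear K) = ratFuncGenerators K := by
  have hne : ∀ d : K, algebraMap K[X] (RatFunc K) (X + C d) ≠ 0 := fun d =>
    RatFunc.algebraMap_ne_zero (X_add_C_ne_zero d)
  apply Set.Subset.antisymm
  · rintro _ ⟨y, rfl⟩
    change K⟮fracLinear K y⟯ = ⊤
    rw [eq_top_iff, ← RatFunc.adjoin_X, adjoin_simple_le_iff]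
    have hmem := mem_adjoin_simple_self K (fracLinear K y)
    have hK : ∀ c : K, algebraMap K (RatFunc K) c ∈ K⟮fracLinear K y⟯ := fun c =>
      K⟮fracLinear K y⟯.algebraMap_mem c
    rcases y with ⟨u, b⟩ | ⟨d, a, e⟩
    · have hu : algebraMap K (RatFunc K) u ≠ 0 := by simp
      have : (RatFunc.X : RatFunc K) = (fracLinear K (.inl (u, b)) - algebraMap K _ b) /
          algebraMap K _ (u : K) := by
        rw [eq_div_iff hu, mul_comm]
        simp [fracLinear]
      rw [this]
      exact div_mem (sub_mem hmem (hK b)) (hK u)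
    · have he : algebraMap K (RatFunc K) e ≠ 0 := by simp
      have h1 : fracLinear K (.inr (d, a, e)) - algebraMap K _ a =
          algebraMap K _ (e : K) / algebraMap K[X] (RatFunc K) (X + C d) := by
        rw [eq_div_iff (hne d), fracLinear, sub_mul, div_mul_cancel₀ _ (hne d)]
        simp
      have : (RatFunc.X : RatFunc K) = algebraMap K _ (e : K) /
          (fracLinear K (.inr (d, a, e)) - algebraMap K _ a) - algebraMap K _ d := by
        rw [h1, div_div_cancel₀ he]
        simp
      rw [this]
      exact sub_mem (div_mem (hK _) (sub_mem hmem (hK _))) (hK _)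
  · intro f (hf : K⟮f⟯ = ⊤)
    have hmax : max f.num.natDegree f.denom.natDegree = 1 := by
      rw [← RatFunc.finrank_eq_max_natDegree, hf]
      exact IntermediateField.finrank_top
    obtain ⟨m, n, hmn⟩ := exists_eq_X_add_C_of_natDegree_le_one
      ((le_max_left _ _).trans hmax.le : f.num.natDegree ≤ 1)
    have hden : f.denom.natDegree ≤ 1 := (le_max_right _ _).trans hmax.le
    rcases Nat.le_one_iff_eq_zero_or_eq_one.1 hden with h0 | h1
    · have hd1 : f.denom = 1 := f.monic_denom.natDegree_eq_zero.1 h0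
      have hm : m ≠ 0 := by
        rintro rfl
        rw [hmn, h0] at hmax
        simp at hmax
      refine ⟨.inl (Units.mk0 m hm, n), ?_⟩
      conv_rhs => rw [← f.num_div_denom, hd1, hmn]
      simp [fracLinear]
    · have hd1 : f.denom = X + C (f.denom.coeff 0) := f.monic_denom.eq_X_add_C h1
      have he : n - m * f.denom.coeff 0 ≠ 0 := by
        intro he
        have hfC : f = RatFunc.C m := by
          conv_lhs => rw [← f.num_div_denom]
          rw [div_eq_iff (RatFunc.algebraMap_ne_zero f.denom_ne_zero), hmn, sub_eq_zero.1 he]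
          conv_rhs => rw [hd1]
          simp
          ring
        rw [hfC] at h1
        simp at h1
      refine ⟨.inr (f.denom.coeff 0, m, Units.mk0 _ he), ?_⟩
      conv_rhs => rw [← f.num_div_denom, hmn, hd1]
      simp only [fracLinear, Units.val_mk0]
      congr 2
      simp
      ring

theorem card_ratFuncGenerators (K : Type*) [Field K] [Finite K] :
    Nat.card (ratFuncGenerators K) = Nat.card K * (Nat.card K ^ 2 - 1) := by
  have hu : Nat.card Kˣ = Nat.card K - 1 := Nat.card_units K
  obtain ⟨n, hn⟩ : ∃ n, Nat.card K = n + 1 :=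
    ⟨Nat.card K - 1, by have := Nat.card_pos (α := K); omega⟩
  rw [← range_fracLinear,
    ← Nat.card_congr (Equiv.ofInjective _ (fracLinear_injective K)), Nat.card_sum, Nat.card_prod,
    Nat.card_prod, Nat.card_prod, hu, hn]
  have : (n + 1) ^ 2 - 1 = n * (n + 2) := by
    rw [show (n + 1) ^ 2 = n * (n + 2) + 1 by ring, Nat.add_sub_cancel]
  rw [this, Nat.add_sub_cancel]
  ring

/-- The order of a group acting faithfully on `K(X)`, for `K` finite, divides `q (q ^ 2 - 1)`
where `q` is the order of `K`. -/
theorem card_dvd_of_injective_algEquiv_ratFunc {K G : Type*} [Field K] [Finite K] [Group G]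
    (ρ : G →* (RatFunc K ≃ₐ[K] RatFunc K)) (hρ : Function.Injective ρ) :
    Nat.card G ∣ Nat.card K * (Nat.card K ^ 2 - 1) := by
  let _ : MulAction G (ratFuncGenerators K) :=
    { smul := fun g f => ⟨ρ g f, by
        change K⟮ρ g f⟯ = ⊤
        have h := congrArg (IntermediateField.map (ρ g).toAlgHom) f.2
        rw [IntermediateField.adjoin_map, Set.image_singleton, ← AlgHom.fieldRange_eq_map] at h
        exact h.trans (AlgEquiv.fieldRange_eq_top _)⟩
      one_smul := fun f => Subtype.ext (by
        change ρ 1 (f : RatFunc K) = f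
        simp)
      mul_smul := fun g h f => Subtype.ext (by
        change ρ (g * h) (f : RatFunc K) = ρ g (ρ h f)
        simp) }
  have hstab : ∀ f : ratFuncGenerators K, MulAction.stabilizer G f = ⊥ := by
    intro f
    rw [eq_bot_iff]
    intro g hg
    have hgf : ρ g (f : RatFunc K) = f := congrArg Subtype.val (MulAction.mem_stabilizer_iff.1 hg)
    refine Subgroup.mem_bot.2 (hρ ?_)
    rw [map_one]
    ext x
    have hx : x ∈ K⟮(f : RatFunc K)⟯ := by
      rw [show K⟮(f : RatFunc K)⟯ = ⊤ from f.2]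
      trivial
    obtain ⟨a, b, rfl⟩ := (mem_adjoin_simple_iff K x).1 hx
    simp only [map_div₀, ← Polynomial.aeval_algHom_apply, AlgEquiv.one_apply]
    rw [hgf]
  rw [← card_ratFuncGenerators, Nat.card_congr (MulAction.selfEquivOrbitsQuotientProd hstab),
    Nat.card_prod]
  exact dvd_mul_left _ _

end Automorphisms

/-- A homomorphism from a domain of transcendence degree at most one that does not collapse some
element to an algebraic one is injective. -/
theorem injective_of_transcendental_of_trdeg_le_one {K L : Type*} {D : Type*} [Field K]
    [CommRing D] [IsDomain D] [Algebra K D] [CommRing L] [Algebra K L]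
    (hD : Algebra.trdeg K D ≤ 1) (φ : D →ₐ[K] L) {y : D} (hy : Transcendental K (φ y)) :
    Function.Injective φ := by
  rw [injective_iff_map_eq_zero]
  intro x hx
  by_contra hx0
  have hyD : Transcendental K y := fun h => hy (h.algHom φ)
  have hind : AlgebraicIndependent K (fun _ : Unit => y) :=
    algebraicIndependent_unique_type_iff.2 hyD
  have hbasis : IsTranscendenceBasis K (fun _ : Unit => y) :=
    hind.isTranscendenceBasis_of_lift_trdeg_le_of_finite (by simpa using hD)
  have halg := hbasis.isAlgebraic
  obtain ⟨⟨r, hr⟩, hr0, z, hz⟩ := (halg.isAlgebraic x).exists_nonzero_dvd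
    (mem_nonZeroDivisors_of_ne_zero hx0)
  rw [Set.range_const, Algebra.adjoin_singleton_eq_range_aeval] at hr
  obtain ⟨F, rfl⟩ := hr
  have hz : Polynomial.aeval y F = x * z := hz
  refine hy ⟨F, ?_, ?_⟩
  · rintro rfl
    exact hr0 (Subtype.ext (by simp))
  · rw [Polynomial.aeval_algHom_apply, hz, map_mul, hx, zero_mul]

/-- Lüroth's theorem for a subfield of transcendence degree one of a rational function field in
several variables over a finite field, generated by finitely many elements. -/
theorem nonempty_algEquiv_ratFunc {K σ : Type*} [Field K] [Finite K] {S : Set (FnField K σ)}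
    (hS : S.Finite) (hdeg : Algebra.trdeg K (IntermediateField.adjoin K S) ≤ 1)
    {y : FnField K σ} (hyS : y ∈ S) (hy : Transcendental K y) :
    Nonempty (IntermediateField.adjoin K S ≃ₐ[K] RatFunc K) := by
  obtain ⟨A, φ, hφ⟩ := exists_algHom_ratFunc_ne_zero
    (hS.union (Set.finite_range fun c => y - algebraMap K (FnField K σ) c))
  have hSA : Algebra.adjoin K S ≤ A := Algebra.adjoin_le fun x hx => (hφ x (.inl hx)).1
  have hyD : y ∈ Algebra.adjoin K S := Algebra.subset_adjoin hyS
  let ψ : Algebra.adjoin K S →ₐ[K] RatFunc K := φ.comp (Subalgebra.inclusion hSA)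
  have hψy : Transcendental K (ψ ⟨y, hyD⟩) := by
    refine RatFunc.transcendental_of_ne_C _ ?_
    rintro ⟨c, hc⟩
    obtain ⟨hA, hne⟩ := hφ _ (.inr ⟨c, rfl⟩)
    refine hne (fun h => hy ?_) ?_
    · rw [sub_eq_zero.1 h]
      exact isAlgebraic_algebraMap c
    · have : (⟨y - algebraMap K (FnField K σ) c, hA⟩ : A) =
          Subalgebra.inclusion hSA ⟨y, hyD⟩ - algebraMap K A c := rfl
      rw [this, map_sub, AlgHom.commutes, RatFunc.algebraMap_eq_C, ← hc]
      exact sub_self _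
  have hDdeg : Algebra.trdeg K (Algebra.adjoin K S) ≤ 1 :=
    (trdeg_le_of_injective
      (Subalgebra.inclusion (IntermediateField.algebra_adjoin_le_adjoin K S))
      (Subalgebra.inclusion_injective _)).trans hdeg
  have hinj := injective_of_transcendental_of_trdeg_le_one hDdeg ψ hψy
  open scoped IntermediateField.algebraAdjoinAdjoin in
  let Ψ : IntermediateField.adjoin K S →ₐ[K] RatFunc K := IsFractionRing.liftAlgHom hinj
  have hΨ : Ψ.fieldRange ≠ ⊥ := by
    intro h
    let y' : IntermediateField.adjoin K S := ⟨y, IntermediateField.subset_adjoin K S hyS⟩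
    have hmem : Ψ y' ∈ Ψ.fieldRange := ⟨y', rfl⟩
    rw [h, IntermediateField.mem_bot] at hmem
    obtain ⟨c, hc⟩ := hmem
    rw [← Ψ.commutes] at hc
    have hcy : algebraMap K (FnField K σ) c = y := congrArg Subtype.val (Ψ.injective hc)
    exact hy (hcy ▸ isAlgebraic_algebraMap c)
  exact ⟨(AlgEquiv.ofInjectiveField Ψ).trans (RatFunc.Luroth.algEquiv hΨ).symm⟩

/-- The restriction of a group action by field automorphisms to a stable intermediate field. -/
def restrictAction {K L G : Type*} [Field K] [Field L] [Algebra K L] [Group G]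
    (ρ : G →* (L ≃ₐ[K] L)) (E : IntermediateField K L) (hE : ∀ g, ∀ x ∈ E, ρ g x ∈ E) :
    G →* (E ≃ₐ[K] E) :=
  (AlgEquiv.algHomUnitsEquiv K E).toMonoidHom.comp <| MonoidHom.toHomUnits
    { toFun := fun g => ((ρ g).toAlgHom.comp E.val).codRestrict E.toSubalgebra
        fun x => hE g x x.2
      map_one' := by
        ext x
        change ρ 1 (x : L) = x
        simp
      map_mul' := fun g h => by
        ext x
        change ρ (g * h) (x : L) = ρ g (ρ h x)
        simp }

theorem coe_restrictAction {K L G : Type*} [Field K] [Field L] [Algebra K L] [Group G]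
    (ρ : G →* (L ≃ₐ[K] L)) (E : IntermediateField K L) (hE : ∀ g, ∀ x ∈ E, ρ g x ∈ E)
    (g : G) (x : E) : (restrictAction ρ E hE g x : L) = ρ g x :=
  rfl

/-- A finite group acting faithfully on a subfield of transcendence degree one of a rational
function field in several variables over a finite field acts faithfully on `K(X)`. -/
theorem exists_injective_hom_algEquiv_ratFunc {K σ G : Type*} [Field K] [Finite K] [Group G]
    [Finite G] (ρ : G →* (FnField K σ ≃ₐ[K] FnField K σ)) (E : IntermediateField K (FnField K σ))
    (hE : ∀ g, ∀ x ∈ E, ρ g x ∈ E) (hfaithful : ∀ g, g ≠ 1 → ∃ x ∈ E, ρ g x ≠ x)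
    (hdeg : Algebra.trdeg K E = 1) :
    ∃ τ : G →* (RatFunc K ≃ₐ[K] RatFunc K), Function.Injective τ := by
  have htr : Algebra.Transcendental K E :=
    trdeg_ne_zero_iff.1 (by rw [hdeg]; exact one_ne_zero)
  obtain ⟨y, hy⟩ := htr.transcendental
  have hfaithful' : ∀ g, ∃ x ∈ E, g ≠ 1 → ρ g x ≠ x := by
    intro g
    by_cases hg : g = 1
    · exact ⟨0, E.zero_mem, fun h => (h hg).elim⟩
    · obtain ⟨x, hx, h⟩ := hfaithful g hg
      exact ⟨x, hx, fun _ => h⟩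
  choose x hxE hx using hfaithful'
  let T : Set (FnField K σ) := insert (y : FnField K σ) (Set.range x)
  have hT : T.Finite := (Set.finite_range x).insert _
  have hTE : T ⊆ E := by
    rintro _ (rfl | ⟨g, rfl⟩)
    · exact y.2
    · exact hxE g
  let S : Set (FnField K σ) := ⋃ g, ρ g '' T
  have hS : S.Finite := Set.finite_iUnion fun g => hT.image _
  have hTS : T ⊆ S := fun t ht => Set.mem_iUnion.2 ⟨1, t, ht, by simp⟩
  have hSE : IntermediateField.adjoin K S ≤ E := by
    rw [IntermediateField.adjoin_le_iff]
    refine Set.iUnion_subset fun g => ?_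
    rintro _ ⟨t, ht, rfl⟩
    exact hE g t (hTE ht)
  have hstable : ∀ g, ∀ z ∈ IntermediateField.adjoin K S,
      ρ g z ∈ IntermediateField.adjoin K S := by
    intro g
    suffices h : IntermediateField.adjoin K S ≤
        (IntermediateField.adjoin K S).comap (ρ g).toAlgHom from fun z hz => h hz
    rw [IntermediateField.adjoin_le_iff]
    refine Set.iUnion_subset fun h => ?_
    rintro _ ⟨t, ht, rfl⟩
    refine IntermediateField.subset_adjoin K S (Set.mem_iUnion.2 ⟨g * h, t, ht, ?_⟩)
    rw [map_mul]
    rfl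
  have hSdeg : Algebra.trdeg K (IntermediateField.adjoin K S) ≤ 1 :=
    (trdeg_le_of_injective (IntermediateField.inclusion hSE)
      (IntermediateField.inclusion hSE).injective).trans hdeg.le
  have hy' : Transcendental K (y : FnField K σ) :=
    (transcendental_algebraMap_iff (algebraMap E (FnField K σ)).injective).2 hy
  obtain ⟨e⟩ := nonempty_algEquiv_ratFunc hS hSdeg (hTS (Set.mem_insert _ _)) hy'
  refine ⟨e.autCongr.toMonoidHom.comp (restrictAction ρ _ hstable),
    e.autCongr.injective.comp ((injective_iff_map_eq_one _).2 fun g hg => ?_)⟩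
  by_contra hg1
  refine hx g hg1 ?_
  have hxS : x g ∈ IntermediateField.adjoin K S :=
    IntermediateField.subset_adjoin K S (hTS (Set.mem_insert_of_mem _ ⟨g, rfl⟩))
  exact congrArg Subtype.val (DFunLike.congr_fun hg ⟨x g, hxS⟩)

theorem trdeg_eq_algebra_trdeg (K L : Type*) [CommRing K] [CommRing L] [Algebra K L] :
    trdeg K L = Algebra.trdeg K L :=
  rfl

theorem trdeg_ratFunc (K : Type*) [Field K] : Algebra.trdeg K (RatFunc K) = 1 := by
  have : Algebra.IsAlgebraic (Polynomial K) (RatFunc K) :=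
    IsLocalization.isAlgebraic _ (nonZeroDivisors (Polynomial K))
  rw [← trdeg_add_eq K (Polynomial K), Polynomial.trdeg_of_isDomain,
    trdeg_eq_zero (R := Polynomial K), add_zero]

/-- The indeterminate of the rational function field attached to an element of the index type. -/
def fnVar (K : Type*) {σ : Type*} [Field K] (i : σ) : FnField K σ :=
  algebraMap (MvPolynomial σ K) (FnField K σ) (MvPolynomial.X i)

theorem galAction_fnVar {K G : Type*} [Field K] [Group G] (g h : G) :
    galAction K G g (fnVar K h) = fnVar K (g * h) := by
  simp [galAction, permGalAction, permHom, fnVar]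

theorem sum_fnVar_ne_zero (K G : Type*) [Field K] [Fintype G] [Nonempty G] :
    ∑ g : G, fnVar K g ≠ 0 := by
  classical
  simp only [fnVar, ← map_sum]
  rw [Ne, IsFractionRing.to_map_eq_zero_iff]
  intro h
  obtain ⟨g⟩ := ‹Nonempty G›
  have := congrArg (MvPolynomial.eval (Pi.single g (1 : K))) h
  simp at this

/-- A homomorphism from a finite group to the additive group of `K` is realised by translations
of an element of the rational function field. -/
theorem exists_galAction_eq_add {K G : Type*} [Field K] [Group G] [Finite G]
    (f : G →* Multiplicative K) :
    ∃ y : FnField K G, ∀ g, galAction K G g y = y + algebraMap K _ (f g).toAdd := by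
  have := Fintype.ofFinite G
  set t : FnField K G := ∑ g : G, fnVar K g with ht
  have ht0 : t ≠ 0 := sum_fnVar_ne_zero K G
  have htfix : ∀ g, galAction K G g t = t := by
    intro g
    rw [ht, map_sum]
    simp only [galAction_fnVar]
    exact Fintype.sum_equiv (Equiv.mulLeft g) _ _ fun _ => rfl
  refine ⟨-((∑ g : G, algebraMap K _ (f g).toAdd * fnVar K g) / t), fun g => ?_⟩
  have hsum : galAction K G g (∑ h : G, algebraMap K (FnField K G) (f h).toAdd * fnVar K h) =
      (∑ h : G, algebraMap K (FnField K G) (f h).toAdd * fnVar K h) -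
        algebraMap K _ (f g).toAdd * t := by
    rw [map_sum, ht, Finset.mul_sum, ← Finset.sum_sub_distrib]
    refine Fintype.sum_equiv (Equiv.mulLeft g) _ _ fun h => ?_
    simp only [map_mul, galAction_fnVar, AlgEquiv.commutes, Equiv.coe_mulLeft, toAdd_mul, map_add]
    ring
  rw [map_neg, map_div₀, htfix, hsum]
  field_simp
  ring

theorem trdeg_ne_zero_of_faithful {K G : Type*} [Field K] [Group G] [Nontrivial G]
    {E : IntermediateField K (FnField K G)}
    (hE : ∀ g : G, g ≠ 1 → ∃ x ∈ E, galAction K G g x ≠ x) : trdeg K E ≠ 0 := by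
  intro h
  rw [trdeg_eq_algebra_trdeg, trdeg_eq_zero_iff] at h
  obtain ⟨g, hg⟩ := exists_ne (1 : G)
  obtain ⟨x, hxE, hx⟩ := hE g hg
  have hxalg : IsAlgebraic K x := (h.isAlgebraic ⟨x, hxE⟩).algHom E.val
  obtain ⟨c, rfl⟩ := mem_range_algebraMap_of_isAlgebraic hxalg
  exact hx (AlgEquiv.commutes _ c)

theorem edK_eq_one_of_injective {K G : Type*} [Field K] [Group G] [Finite G] [Nontrivial G]
    (f : G →* Multiplicative K) (hf : Function.Injective f) : edK K G = 1 := by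
  obtain ⟨y, hy⟩ := exists_galAction_eq_add f
  have hmoved : ∀ g : G, g ≠ 1 → galAction K G g y ≠ y := by
    intro g hg h
    rw [hy, add_eq_left, map_eq_zero, toAdd_eq_zero] at h
    exact hg (hf (h.trans (map_one f).symm))
  have hytr : Transcendental K y := by
    intro h
    obtain ⟨c, rfl⟩ := mem_range_algebraMap_of_isAlgebraic h
    obtain ⟨g, hg⟩ := exists_ne (1 : G)
    exact hmoved g hg (AlgEquiv.commutes _ c)
  have hfaithful : ∀ g : G, g ≠ 1 →
      ∃ x ∈ IntermediateField.adjoin K {y}, galAction K G g x ≠ x := fun g hg =>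
    ⟨y, IntermediateField.mem_adjoin_simple_self K y, hmoved g hg⟩
  have hstable : ∀ g : G, ∀ x ∈ IntermediateField.adjoin K {y},
      galAction K G g x ∈ IntermediateField.adjoin K {y} := by
    intro g
    suffices h : IntermediateField.adjoin K {y} ≤
        (IntermediateField.adjoin K {y}).comap (galAction K G g).toAlgHom from fun z hz => h hz
    rw [IntermediateField.adjoin_simple_le_iff]
    change galAction K G g y ∈ IntermediateField.adjoin K {y}
    rw [hy]
    exact add_mem (IntermediateField.mem_adjoin_simple_self K y)
      (IntermediateField.algebraMap_mem _ _)
  have hdeg : trdeg K (IntermediateField.adjoin K {y}) = (1 : ℕ) := by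
    have := (RatFunc.algEquivOfTranscendental y hytr).lift_trdeg_eq
    rw [trdeg_ratFunc] at this
    simpa [trdeg_eq_algebra_trdeg] using this.symm
  refine le_antisymm (Nat.sInf_le ⟨_, hstable, hfaithful, hdeg⟩)
    (le_csInf ⟨1, _, hstable, hfaithful, hdeg⟩ ?_)
  rintro d ⟨E, -, hE, hd⟩
  have := trdeg_ne_zero_of_faithful hE
  rw [hd, Nat.cast_ne_zero] at this
  exact Nat.one_le_iff_ne_zero.2 this

/-- If a finite group has essential dimension one over a finite field of order `q`, then its
order divides `q (q ^ 2 - 1)`. -/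
theorem card_dvd_of_edK_eq_one {K G : Type*} [Field K] [Finite K] [Group G] [Finite G]
    (h : edK K G = 1) : Nat.card G ∣ Nat.card K * (Nat.card K ^ 2 - 1) := by
  have hmem := Nat.sInf_mem (Nat.nonempty_of_sInf_eq_succ h)
  obtain ⟨E, hE, hfaithful, hdeg⟩ := hmem
  change trdeg K E = (edK K G : Cardinal) at hdeg
  rw [h, Nat.cast_one] at hdeg
  obtain ⟨τ, hτ⟩ := exists_injective_hom_algEquiv_ratFunc (galAction K G) E hE hfaithful hdeg
  exact card_dvd_of_injective_algEquiv_ratFunc τ hτ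

/-- Let `p` be a prime and `K` a field of characteristic `p`. For every `r ≥ 1`,
`ed_K((ℤ/pℤ)^r) = 1` if and only if `[K : 𝔽_p] ≥ r`, that is, the dimension of `K` as a
vector space over its prime field `𝔽_p = ZMod p` is at least `r`. -/
theorem edK_elementaryAbelian_eq_one_iff (K : Type*) [Field K] (p : ℕ) (hp : p.Prime)
    [CharP K p] (r : ℕ) (hr : 0 < r) :
    letI : Algebra (ZMod p) K := ZMod.algebra K p
    (edK K (Fin r → Multiplicative (ZMod p)) = 1 ↔
      (r : Cardinal) ≤ Module.rank (ZMod p) K) := by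
  let _ : Algebra (ZMod p) K := ZMod.algebra K p
  have : Fact p.Prime := ⟨hp⟩
  have : NeZero r := ⟨hr.ne'⟩
  constructor
  · intro h
    rcases finite_or_infinite K with hK | hK
    · have hdvd := card_dvd_of_edK_eq_one h
      have hcard : Nat.card K = p ^ Module.finrank (ZMod p) K := by
        rw [Module.natCard_eq_pow_finrank (K := ZMod p), Nat.card_zmod]
      have hn : 0 < Module.finrank (ZMod p) K := Module.finrank_pos
      rw [Nat.card_fun, Nat.card_eq_fintype_card (α := Multiplicative (ZMod p)),
        Fintype.card_multiplicative, ZMod.card, Nat.card_fin, hcard] at hdvd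
      have hpdvd : p ∣ (p ^ Module.finrank (ZMod p) K) ^ 2 :=
        dvd_pow (dvd_pow_self p hn.ne') two_ne_zero
      have hcop : (p ^ r).Coprime ((p ^ Module.finrank (ZMod p) K) ^ 2 - 1) := by
        refine Nat.Coprime.pow_left r ((Nat.Prime.coprime_iff_not_dvd hp).2 fun hd => ?_)
        have hpos : 1 ≤ (p ^ Module.finrank (ZMod p) K) ^ 2 := Nat.one_le_pow _ _ (pow_pos hp.pos _)
        have := (Nat.dvd_sub_iff_right hpos hpdvd).1 hd
        exact hp.one_lt.ne' (Nat.dvd_one.1 this)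
      rw [← Module.finrank_eq_rank, Nat.cast_le]
      exact (Nat.pow_dvd_pow_iff_le_right hp.one_lt).1 (hcop.dvd_of_dvd_mul_right hdvd)
    · refine (Cardinal.natCast_lt_aleph0).le.trans ?_
      by_contra! hlt
      have := Module.rank_lt_aleph0_iff.1 hlt
      have : Finite K := Module.finite_of_finite (ZMod p)
      exact not_finite K
  · intro h
    obtain ⟨v, hv⟩ := (Module.le_rank_iff_exists_linearMap).1 h
    refine edK_eq_one_of_injective
      { toFun := fun g => Multiplicative.ofAdd (v fun i => (g i).toAdd)
        map_one' := congrArg Multiplicative.ofAdd (map_zero v)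
        map_mul' := fun g h => congrArg Multiplicative.ofAdd
          (map_add v (fun i => (g i).toAdd) fun i => (h i).toAdd) } fun g h hgh => ?_
    exact hv (Multiplicative.ofAdd.injective hgh)
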